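/- Let V be a finite set of vertices, E ⊆ V × V, and l, r : E → [0,1] with l(e) ≤ r(e) for all e ∈ E. Fix k and let OPT_p = max{σ_p(T) : T ⊆ V, |T| = k} for p : E → [0,1]. Suppose S⁺ ⊆ V with |S⁺| = k satisfies the greedy guarantee σ_r(S⁺) ≥ (1 − 1/e)·OPT_r, let S⁻ ⊆ V with |S⁻| = k be arbitrary, and let S^LU be whichever of S⁻, S⁺ has the larger value of σ_l. Then for every p : E → [0,1] with l(e) ≤ p(e) ≤ r(e) for all e ∈ E, σ_p(S^LU) · σ_r(S⁺) ≥ (1 − 1/e) · σ_l(S^LU) · OPT_p. In particular, when σ_r(S⁺) > 0 and OPT_p > 0, the robust ratio satisfies σ_p(S^LU)/OPT_p ≥ α · (1 − 1/e), where α = σ_l(S^LU)/σ_r(S⁺) is the gap ratio. -/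

import Mathlib

open scoped Classical

/-- The probability weight of a live-edge graph `H ⊆ E` under edge probabilities `p`. -/
noncomputable def liveEdgeWeight {V : Type*} [DecidableEq V]
    (E : Finset (V × V)) (p : V × V → ℝ) (H : Finset (V × V)) : ℝ :=
  (∏ e ∈ H, p e) * ∏ e ∈ E \ H, (1 - p e)

/-- The set of vertices reachable from the seed set `S` using only the edges of `H`. -/
noncomputable def reachSet {V : Type*} [Fintype V]
    (H : Finset (V × V)) (S : Finset V) : Finset V :=
  Finset.univ.filter
    (fun v => ∃ s ∈ S, Relation.ReflTransGen (fun a b => (a, b) ∈ H) s v)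

/-- The Independent Cascade influence spread of a seed set `S`. -/
noncomputable def icSpread {V : Type*} [Fintype V] [DecidableEq V]
    (E : Finset (V × V)) (p : V × V → ℝ) (S : Finset V) : ℝ :=
  ∑ H ∈ E.powerset, liveEdgeWeight E p H * ((reachSet H S).card : ℝ)

/-- The expectation of a monotone set function over a random subset of `E`, containing each
`e ∈ E` independently with probability `p e`, is monotone in `p`. -/
theorem sum_powerset_prod_mul_le_of_monotone {α : Type*} [DecidableEq α] (E : Finset α)
    (p q : α → ℝ) (hp : ∀ e ∈ E, 0 ≤ p e) (hq : ∀ e ∈ E, q e ≤ 1) (hpq : ∀ e ∈ E, p e ≤ q e)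
    (f : Finset α → ℝ) (hf : Monotone f) :
    ∑ H ∈ E.powerset, ((∏ e ∈ H, p e) * ∏ e ∈ E \ H, (1 - p e)) * f H ≤
      ∑ H ∈ E.powerset, ((∏ e ∈ H, q e) * ∏ e ∈ E \ H, (1 - q e)) * f H := by
  induction E using Finset.induction_on generalizing f with
  | empty => simp
  | insert a E ha ih =>
    have expand : ∀ u : α → ℝ,
        ∑ H ∈ (insert a E).powerset,
            ((∏ e ∈ H, u e) * ∏ e ∈ insert a E \ H, (1 - u e)) * f H =
          ∑ H ∈ E.powerset, ((∏ e ∈ H, u e) * ∏ e ∈ E \ H, (1 - u e)) *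
            ((1 - u a) * f H + u a * f (insert a H)) := by
      intro u
      rw [Finset.sum_powerset_insert ha, ← Finset.sum_add_distrib]
      refine Finset.sum_congr rfl fun H hH => ?_
      have haH : a ∉ H := fun h => ha (Finset.mem_powerset.1 hH h)
      have hsdiff : insert a E \ insert a H = E \ H := by
        ext x
        by_cases hx : x = a <;> simp [hx, ha]
      rw [Finset.insert_sdiff_of_notMem _ haH, Finset.prod_insert (by simp [ha]), hsdiff,
        Finset.prod_insert haH]
      ring
    simp only [Finset.forall_mem_insert] at hp hq hpq
    have hmono : Monotone fun H => (1 - p a) * f H + p a * f (insert a H) := by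
      intro H K hHK
      have h₁ := mul_le_mul_of_nonneg_left (hf hHK)
        (sub_nonneg.2 (hpq.1.trans hq.1) : 0 ≤ 1 - p a)
      have h₂ := mul_le_mul_of_nonneg_left (hf (Finset.insert_subset_insert a hHK)) hp.1
      exact add_le_add h₁ h₂
    rw [expand p, expand q]
    refine (ih hp.2 hq.2 hpq.2 _ hmono).trans (Finset.sum_le_sum fun H hH => ?_)
    refine mul_le_mul_of_nonneg_left ?_ (mul_nonneg ?_ ?_)
    · nlinarith [mul_le_mul_of_nonneg_left (hf (Finset.subset_insert a H)) (sub_nonneg.2 hpq.1)]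
    · exact Finset.prod_nonneg fun e he =>
        (hp.2 e (Finset.mem_powerset.1 hH he)).trans (hpq.2 e (Finset.mem_powerset.1 hH he))
    · exact Finset.prod_nonneg fun e he => sub_nonneg.2 (hq.2 e (Finset.mem_sdiff.1 he).1)

/-- More live edges reach more vertices. -/
theorem reachSet_mono {V : Type*} [Fintype V] (S : Finset V) :
    Monotone fun H : Finset (V × V) => reachSet H S := by
  intro H K hHK v hv
  simp only [reachSet, Finset.mem_filter, Finset.mem_univ, true_and] at hv ⊢
  obtain ⟨s, hs, hsv⟩ := hv
  exact ⟨s, hs, Relation.ReflTransGen.mono (fun _ _ h => hHK h) _ _ hsv⟩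

/-- The influence spread is monotone in the edge probabilities. -/
theorem icSpread_mono {V : Type*} [Fintype V] [DecidableEq V] (E : Finset (V × V))
    (p q : V × V → ℝ) (hp : ∀ e ∈ E, 0 ≤ p e) (hq : ∀ e ∈ E, q e ≤ 1)
    (hpq : ∀ e ∈ E, p e ≤ q e) (S : Finset V) :
    icSpread E p S ≤ icSpread E q S :=
  sum_powerset_prod_mul_le_of_monotone E p q hp hq hpq
    (fun H => ((reachSet H S).card : ℝ))
    fun _ _ h => Nat.cast_le.2 (Finset.card_le_card (reachSet_mono S h))

/-- The influence spread is nonnegative. -/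
theorem icSpread_nonneg {V : Type*} [Fintype V] [DecidableEq V] (E : Finset (V × V))
    (p : V × V → ℝ) (hp₀ : ∀ e ∈ E, 0 ≤ p e) (hp₁ : ∀ e ∈ E, p e ≤ 1) (S : Finset V) :
    0 ≤ icSpread E p S := by
  refine Finset.sum_nonneg fun H hH => mul_nonneg (mul_nonneg ?_ ?_) (Nat.cast_nonneg _)
  · exact Finset.prod_nonneg fun e he => hp₀ e (Finset.mem_powerset.1 hH he)
  · exact Finset.prod_nonneg fun e he => sub_nonneg.2 (hp₁ e (Finset.mem_sdiff.1 he).1)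

/-- The LUGreedy guarantee for Robust Influence Maximization: if `S⁺` satisfies the
greedy `(1-1/e)` guarantee for the upper probabilities `r`, and `S^LU` is whichever of
`S⁻, S⁺` has the larger spread under the lower probabilities `l`, then for every
probability vector `p` in the interval parameter space, the robust ratio of `S^LU`
is at least `α (1 - 1/e)`, where `α = σ_l(S^LU) / σ_r(S⁺)` is the gap ratio. -/
theorem luGreedy_robust_guarantee {V : Type*} [Fintype V] [DecidableEq V]
    (E : Finset (V × V)) (l r : V × V → ℝ)
    (hl0 : ∀ e ∈ E, 0 ≤ l e) (hr1 : ∀ e ∈ E, r e ≤ 1) (hlr : ∀ e ∈ E, l e ≤ r e)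
    (k : ℕ) (Sp Sm SLU : Finset V)
    (hSp : Sp.card = k) (hSm : Sm.card = k)
    (OPTr : ℝ)
    (hOPTr : IsGreatest {x : ℝ | ∃ T : Finset V, T.card = k ∧ x = icSpread E r T} OPTr)
    (hgreedy : (1 - 1 / Real.exp 1) * OPTr ≤ icSpread E r Sp)
    (hSLU : (SLU = Sm ∨ SLU = Sp) ∧
      icSpread E l SLU = max (icSpread E l Sm) (icSpread E l Sp)) :
    ∀ p : V × V → ℝ, (∀ e ∈ E, l e ≤ p e ∧ p e ≤ r e) →
      ∀ OPTp : ℝ,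
        IsGreatest {x : ℝ | ∃ T : Finset V, T.card = k ∧ x = icSpread E p T} OPTp →
        ((1 - 1 / Real.exp 1) * (icSpread E l SLU * OPTp) ≤
          icSpread E p SLU * icSpread E r Sp) ∧
        (0 < icSpread E r Sp → 0 < OPTp →
          (icSpread E l SLU / icSpread E r Sp) * (1 - 1 / Real.exp 1) ≤
            icSpread E p SLU / OPTp) := by
  intro p hp OPTp hOPTp
  have hp₀ : ∀ e ∈ E, 0 ≤ p e := fun e he => (hl0 e he).trans (hp e he).1
  have hp₁ : ∀ e ∈ E, p e ≤ 1 := fun e he => (hp e he).2.trans (hr1 e he)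
  have hl_nonneg : 0 ≤ icSpread E l SLU :=
    icSpread_nonneg E l hl0 (fun e he => (hlr e he).trans (hr1 e he)) SLU
  have hlp : icSpread E l SLU ≤ icSpread E p SLU :=
    icSpread_mono E l p hl0 hp₁ (fun e he => (hp e he).1) SLU
  have hr_nonneg : 0 ≤ icSpread E r Sp :=
    icSpread_nonneg E r (fun e he => (hl0 e he).trans (hlr e he)) hr1 Sp
  have hOPT : OPTp ≤ OPTr := by
    obtain ⟨T, hT, rfl⟩ := hOPTp.1
    exact (icSpread_mono E p r hp₀ hr1 (fun e he => (hp e he).2) T).trans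
      (hOPTr.2 ⟨T, hT, rfl⟩)
  have hc : 0 ≤ 1 - 1 / Real.exp 1 := by
    rw [sub_nonneg, div_le_one (Real.exp_pos 1)]
    exact Real.one_le_exp zero_le_one
  have hmain : (1 - 1 / Real.exp 1) * (icSpread E l SLU * OPTp) ≤
      icSpread E p SLU * icSpread E r Sp :=
    calc (1 - 1 / Real.exp 1) * (icSpread E l SLU * OPTp)
        = icSpread E l SLU * ((1 - 1 / Real.exp 1) * OPTp) := by ring
      _ ≤ icSpread E l SLU * icSpread E r Sp :=
          mul_le_mul_of_nonneg_left
            ((mul_le_mul_of_nonneg_left hOPT hc).trans hgreedy) hl_nonneg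
      _ ≤ icSpread E p SLU * icSpread E r Sp := mul_le_mul_of_nonneg_right hlp hr_nonneg
  refine ⟨hmain, fun hr_pos hOPTp_pos => ?_⟩
  rw [div_mul_eq_mul_div, div_le_div_iff₀ hr_pos hOPTp_pos]
  linarith
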